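/- Let X be a simplicial complex and q ≥ 2. Define q-simplices σ, σ' to be q-connected if there is a sequence of q-simplices from σ to σ' in which consecutive simplices share a (q−1)-face. Let X_1, X_2 be subcomplexes of X such that the (q−1)-simplices of X_1 and X_2 together cover those of X, the q-simplices of X_1 and X_2 together cover those of X, and no (q−1)-simplex of X_1 is (q−1)-connected in X to a (q−1)-simplex of X_2. Then the map (z_1, z_2) ↦ z_1 + z_2 induces an isomorphism H_{q−1}(X_1) ⊕ H_{q−1}(X_2) ≅ H_{q−1}(X) of simplicial homology with Z/2 coefficients. -/

import Mathlib

open scoped Classical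

/-- An abstract simplicial complex on the vertex set `V`: a set of finite
simplices closed under taking subsets. -/
def IsComplex {V : Type*} (X : Set (Finset V)) : Prop :=
  ∀ s ∈ X, ∀ t : Finset V, t ⊆ s → t ∈ X

/-- The `q`-simplices of `X` (of cardinality `q + 1`). -/
def simplices {V : Type*} (X : Set (Finset V)) (q : ℕ) : Set (Finset V) :=
  {s | s ∈ X ∧ s.card = q + 1}

/-- The `ZMod 2` simplicial boundary operator on chains (functions from finite
vertex sets to `ZMod 2`): the coefficient of `τ` in `∂c` is the sum of the
coefficients of the sets `τ ∪ {x}`, `x ∉ τ`. -/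
noncomputable def sBdry (V : Type*) [Fintype V] [DecidableEq V] :
    (Finset V → ZMod 2) →ₗ[ZMod 2] (Finset V → ZMod 2) :=
  LinearMap.pi fun τ => ∑ x ∈ τᶜ, LinearMap.proj (insert x τ)

/-- Chains supported on a set `S` of simplices. -/
def sOn {V : Type*} (S : Set (Finset V)) : Submodule (ZMod 2) (Finset V → ZMod 2) :=
  ⨅ s ∈ Sᶜ, LinearMap.ker (LinearMap.proj (R := ZMod 2) (φ := fun _ : Finset V => ZMod 2) s)

/-- The `q`-chains of `X` over `ZMod 2`. -/
def sChains {V : Type*} (X : Set (Finset V)) (q : ℕ) :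
    Submodule (ZMod 2) (Finset V → ZMod 2) :=
  sOn (simplices X q)

/-- The `q`-cycles of `X` over `ZMod 2`. -/
noncomputable def sCycles {V : Type*} [Fintype V] [DecidableEq V]
    (X : Set (Finset V)) (q : ℕ) : Submodule (ZMod 2) (Finset V → ZMod 2) :=
  sChains X q ⊓ LinearMap.ker (sBdry V)

/-- The `q`-boundaries of `X` over `ZMod 2`: boundaries of `(q+1)`-chains. -/
noncomputable def sBdries {V : Type*} [Fintype V] [DecidableEq V]
    (X : Set (Finset V)) (q : ℕ) : Submodule (ZMod 2) (Finset V → ZMod 2) :=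
  Submodule.map (sBdry V) (sChains X (q + 1))

/-- The `q`-th simplicial homology of `X` over `ZMod 2`. -/
abbrev sH {V : Type*} [Fintype V] [DecidableEq V] (X : Set (Finset V)) (q : ℕ) :=
  ↥(sCycles X q) ⧸ ((sBdries X q).comap (sCycles X q).subtype)

/-- Two `q`-simplices (cardinality `q + 1`) share a `(q-1)`-face (of
cardinality `q`). -/
def ShareFace {V : Type*} (q : ℕ) (a b : Finset V) : Prop :=
  a.card = q + 1 ∧ b.card = q + 1 ∧ ∃ t : Finset V, t.card = q ∧ t ⊆ a ∧ t ⊆ b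

/-- `q`-connectivity of `q`-simplices in `X`: the reflexive-transitive closure
of sharing a `(q-1)`-face within `X`. -/
def QConn {V : Type*} (X : Set (Finset V)) (q : ℕ) (a b : Finset V) : Prop :=
  Relation.ReflTransGen (fun x y => x ∈ X ∧ y ∈ X ∧ ShareFace q x y) a b

theorem mem_sOn {V : Type*} {S : Set (Finset V)} {c : Finset V → ZMod 2} :
    c ∈ sOn S ↔ ∀ s ∉ S, c s = 0 := by
  simp [sOn, Submodule.mem_iInf]

theorem sOn_mono {V : Type*} {S T : Set (Finset V)} (h : S ⊆ T) : sOn S ≤ sOn T :=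
  fun _ hc => mem_sOn.2 fun s hs => mem_sOn.1 hc s fun hs' => hs (h hs')

/-- A chain supported on a union splits into chains supported on the two parts. -/
theorem exists_add_eq_of_mem_sOn_union {V : Type*} {S T : Set (Finset V)}
    {c : Finset V → ZMod 2} (hc : c ∈ sOn (S ∪ T)) :
    ∃ a ∈ sOn S, ∃ b ∈ sOn T, a + b = c := by
  refine ⟨S.indicator c, mem_sOn.2 fun s hs => Set.indicator_of_notMem hs c,
    Sᶜ.indicator c, mem_sOn.2 fun s hs => ?_, Set.indicator_self_add_compl S c⟩
  by_cases h : s ∈ S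
  · simp [h]
  · have : c s = 0 := mem_sOn.1 hc s (by simp [h, hs])
    simp [this]

theorem disjoint_sOn {V : Type*} {S T : Set (Finset V)} (h : Disjoint S T) :
    Disjoint (sOn S) (sOn T) := by
  rw [Submodule.disjoint_def]
  intro c hS hT
  funext s
  by_cases hs : s ∈ S
  · exact mem_sOn.1 hT s (Set.disjoint_left.1 h hs)
  · exact mem_sOn.1 hS s hs

theorem simplices_mono {V : Type*} {X Y : Set (Finset V)} (h : X ⊆ Y) (p : ℕ) :
    simplices X p ⊆ simplices Y p :=
  fun _ hs => ⟨h hs.1, hs.2⟩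

section Boundary

variable {V : Type*} [Fintype V] [DecidableEq V]

theorem sBdry_apply (c : Finset V → ZMod 2) (τ : Finset V) :
    sBdry V c τ = ∑ x ∈ τᶜ, c (insert x τ) := by
  simp [sBdry]

theorem exists_insert_mem_of_sBdry_ne_zero {S : Set (Finset V)} {c : Finset V → ZMod 2}
    (hc : c ∈ sOn S) {τ : Finset V} (h : sBdry V c τ ≠ 0) : ∃ x ∉ τ, insert x τ ∈ S := by
  rw [sBdry_apply] at h
  obtain ⟨x, hx, hne⟩ := Finset.exists_ne_zero_of_sum_ne_zero h
  exact ⟨x, Finset.mem_compl.1 hx, by_contra fun hS => hne (mem_sOn.1 hc _ hS)⟩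

theorem sBdries_le_sChains {X : Set (Finset V)} (hX : IsComplex X) (p : ℕ) :
    sBdries X p ≤ sChains X p := by
  rintro _ ⟨c, hc, rfl⟩
  refine mem_sOn.2 fun τ hτ => by_contra fun hne => hτ ?_
  obtain ⟨x, hx, hmem, hcard⟩ := exists_insert_mem_of_sBdry_ne_zero hc hne
  rw [Finset.card_insert_of_notMem hx] at hcard
  exact ⟨hX _ hmem _ (Finset.subset_insert x τ), by omega⟩

theorem sCycles_mono {X Y : Set (Finset V)} (h : X ⊆ Y) (p : ℕ) : sCycles X p ≤ sCycles Y p :=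
  inf_le_inf_right _ (sOn_mono (simplices_mono h p))

theorem sBdries_mono {X Y : Set (Finset V)} (h : X ⊆ Y) (p : ℕ) : sBdries X p ≤ sBdries Y p :=
  Submodule.map_mono (sOn_mono (simplices_mono h (p + 1)))

/-- The map on homology induced by the inclusion of a subcomplex. -/
noncomputable def sHMap {X Y : Set (Finset V)} (h : X ⊆ Y) (p : ℕ) : sH X p →ₗ[ZMod 2] sH Y p :=
  Submodule.mapQ _ _ (Submodule.inclusion (sCycles_mono h p)) fun _ hz => sBdries_mono h p hz

/-- Cycles split along a decomposition of the `p`-simplices into two parts that share no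
`(p-1)`-face. -/
theorem exists_cycles_add_eq {X X₁ X₂ : Set (Finset V)} {p : ℕ}
    (hcov : simplices X p = simplices X₁ p ∪ simplices X₂ p)
    (hsep : ∀ a ∈ simplices X₁ p, ∀ b ∈ simplices X₂ p, ¬ ShareFace p a b)
    {z : Finset V → ZMod 2} (hz : z ∈ sCycles X p) :
    ∃ a ∈ sCycles X₁ p, ∃ b ∈ sCycles X₂ p, a + b = z := by
  obtain ⟨hz, hz0⟩ := hz
  rw [sChains, hcov] at hz
  obtain ⟨a, ha, b, hb, rfl⟩ := exists_add_eq_of_mem_sOn_union hz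
  have hab : ∀ τ, sBdry V a τ + sBdry V b τ = 0 := fun τ => by
    have h : sBdry V (a + b) = 0 := hz0
    rw [map_add] at h
    exact congrFun h τ
  have key : ∀ τ, sBdry V a τ = 0 ∨ sBdry V b τ = 0 := fun τ => by
    by_contra! hne
    obtain ⟨x, hx, hmx⟩ := exists_insert_mem_of_sBdry_ne_zero ha hne.1
    obtain ⟨y, -, hmy⟩ := exists_insert_mem_of_sBdry_ne_zero hb hne.2
    have hcard := hmx.2
    rw [Finset.card_insert_of_notMem hx] at hcard
    exact hsep _ hmx _ hmy ⟨hmx.2, hmy.2, τ, by omega, Finset.subset_insert _ _,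
      Finset.subset_insert _ _⟩
  refine ⟨a, ⟨ha, funext fun τ => ?_⟩, b, ⟨hb, funext fun τ => ?_⟩, rfl⟩
  · rcases key τ with h | h
    · exact h
    · simpa [h] using hab τ
  · rcases key τ with h | h
    · simpa [h] using hab τ
    · exact h

/-- If a sum of chains on two disjoint sets of `p`-simplices bounds, each summand bounds. -/
theorem mem_sBdries_of_add_mem {X X₁ X₂ : Set (Finset V)} {p : ℕ}
    (hX₁ : IsComplex X₁) (hX₂ : IsComplex X₂)
    (hcov : simplices X (p + 1) = simplices X₁ (p + 1) ∪ simplices X₂ (p + 1))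
    (hdisj : Disjoint (simplices X₁ p) (simplices X₂ p))
    {a b : Finset V → ZMod 2} (ha : a ∈ sChains X₁ p) (hb : b ∈ sChains X₂ p)
    (hab : a + b ∈ sBdries X p) : a ∈ sBdries X₁ p ∧ b ∈ sBdries X₂ p := by
  obtain ⟨c, hc, hcab⟩ := hab
  rw [sChains, hcov] at hc
  obtain ⟨c₁, hc₁, c₂, hc₂, rfl⟩ := exists_add_eq_of_mem_sOn_union hc
  have h₁ : sBdry V c₁ ∈ sBdries X₁ p := Submodule.mem_map_of_mem hc₁
  have h₂ : sBdry V c₂ ∈ sBdries X₂ p := Submodule.mem_map_of_mem hc₂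
  rw [map_add] at hcab
  have heq : a - sBdry V c₁ = sBdry V c₂ - b := by
    rw [sub_eq_sub_iff_add_eq_add, ← hcab, add_comm]
  have hzero : a - sBdry V c₁ = 0 :=
    Submodule.disjoint_def.1 (disjoint_sOn hdisj) _
      (sub_mem ha (sBdries_le_sChains hX₁ p h₁))
      (heq ▸ sub_mem (sBdries_le_sChains hX₂ p h₂) hb)
  rw [sub_eq_zero.1 (heq.symm.trans hzero)] at h₂
  rw [← sub_eq_zero.1 hzero] at h₁
  exact ⟨h₁, h₂⟩

end Boundary

/-- with `X₁`, `X₂` subcomplexes of `X` covering its `(q-1)`- and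
`q`-simplices, and no `(q-1)`-simplex of `X₁` being `(q-1)`-connected in `X` to
a `(q-1)`-simplex of `X₂`, the map `(z₁, z₂) ↦ z₁ + z₂` induces an isomorphism
`H_{q-1}(X₁) ⊕ H_{q-1}(X₂) ≅ H_{q-1}(X)` of `ZMod 2` simplicial homology. -/
theorem stmt_8 {V : Type*} [Fintype V] [DecidableEq V]
    (X X₁ X₂ : Set (Finset V)) (q : ℕ) (hq : 2 ≤ q)
    (hX : IsComplex X) (hX₁ : IsComplex X₁) (hX₂ : IsComplex X₂)
    (hs₁ : X₁ ⊆ X) (hs₂ : X₂ ⊆ X)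
    (hcov₁ : simplices X (q - 1) = simplices X₁ (q - 1) ∪ simplices X₂ (q - 1))
    (hcov₂ : simplices X q = simplices X₁ q ∪ simplices X₂ q)
    (hsep : ∀ a ∈ simplices X₁ (q - 1), ∀ b ∈ simplices X₂ (q - 1),
      ¬ QConn X (q - 1) a b) :
    ∃ θ : (sH X₁ (q - 1) × sH X₂ (q - 1)) ≃ₗ[ZMod 2] sH X (q - 1),
      ∀ (c d : Finset V → ZMod 2)
        (hc : c ∈ sCycles X₁ (q - 1)) (hd : d ∈ sCycles X₂ (q - 1))
        (hcd : c + d ∈ sCycles X (q - 1)),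
        θ (Submodule.Quotient.mk ⟨c, hc⟩, Submodule.Quotient.mk ⟨d, hd⟩) =
          Submodule.Quotient.mk ⟨c + d, hcd⟩ := by
  obtain ⟨p, rfl⟩ : ∃ p, q = p + 1 := ⟨q - 1, by omega⟩
  simp only [Nat.add_sub_cancel] at *
  have hdisj : Disjoint (simplices X₁ p) (simplices X₂ p) :=
    Set.disjoint_left.2 fun a h₁ h₂ => hsep a h₁ a h₂ .refl
  have hface : ∀ a ∈ simplices X₁ p, ∀ b ∈ simplices X₂ p, ¬ ShareFace p a b :=
    fun a ha b hb h => hsep a ha b hb (.single ⟨hs₁ ha.1, hs₂ hb.1, h⟩)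
  refine ⟨LinearEquiv.ofBijective ((sHMap hs₁ p).coprod (sHMap hs₂ p)) ⟨?_, ?_⟩,
    fun c d hc hd hcd => rfl⟩
  · rw [← LinearMap.ker_eq_bot, LinearMap.ker_eq_bot']
    rintro ⟨u, v⟩ h
    obtain ⟨a, rfl⟩ := Submodule.Quotient.mk_surjective _ u
    obtain ⟨b, rfl⟩ := Submodule.Quotient.mk_surjective _ v
    have hmk : (Submodule.Quotient.mk (Submodule.inclusion (sCycles_mono hs₁ p) a +
        Submodule.inclusion (sCycles_mono hs₂ p) b) : sH X p) = 0 := h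
    have hab : (a : Finset V → ZMod 2) + b ∈ sBdries X p :=
      (Submodule.Quotient.mk_eq_zero ((sBdries X p).comap (sCycles X p).subtype)).1 hmk
    obtain ⟨ha, hb⟩ := mem_sBdries_of_add_mem hX₁ hX₂ hcov₂ hdisj a.2.1 b.2.1 hab
    exact Prod.ext ((Submodule.Quotient.mk_eq_zero _).2 ha)
      ((Submodule.Quotient.mk_eq_zero _).2 hb)
  · intro w
    obtain ⟨⟨z, hz⟩, rfl⟩ := Submodule.Quotient.mk_surjective _ w
    obtain ⟨a, ha, b, hb, rfl⟩ := exists_cycles_add_eq hcov₁ hface hz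
    exact ⟨(Submodule.Quotient.mk ⟨a, ha⟩, Submodule.Quotient.mk ⟨b, hb⟩), rfl⟩
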